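/- arXiv:2203.06057 — 2 statements merged into one kernel-verified Lean document; each statement's English description precedes it below -/
import Mathlib

section
/- Let λ be a Lévy measure on (0,∞). Then the integral ∫_0^t ∫_{ℝ^d} ∫_{(0,∞)} min(1, g(s,y) z) λ(dz) dy ds is finite if and only if ∫_{(1,∞)} (log z)^{d/2} λ(dz) < ∞ and ∫_{(0,1]} z λ(dz) < ∞. -/
open MeasureTheory Real Filter Set
open scoped ENNReal Topology

noncomputable section

/-- The heat kernel on `ℝ^d` with diffusion constant `κ`. -/
def heatKernel (d : ℕ) (κ : ℝ) (s : ℝ) (x : EuclideanSpace ℝ (Fin d)) : ℝ :=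
  (2 * π * κ * s) ^ (-(d : ℝ) / 2) * Real.exp (-‖x‖ ^ 2 / (2 * κ * s))

/-- A Lévy measure on `(0,∞)`: a nonzero Borel measure carried by `(0,∞)`
with `∫ min(1, z²) λ(dz) < ∞`. -/
def IsLevyMeasure (lam : Measure ℝ) : Prop :=
  lam ≠ 0 ∧ lam (Set.Iic 0) = 0 ∧
    ∫⁻ z in Set.Ioi (0 : ℝ), ENNReal.ofReal (min 1 (z ^ 2)) ∂lam < ⊤

/-- `η̄(r) = (Leb ⊗ Leb ⊗ λ)({(s,y,z) ∈ (0,t] × ℝ^d × (0,∞) : g(s,y) z > r})`. -/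
def etaBar (d : ℕ) (κ t : ℝ) (lam : Measure ℝ) (r : ℝ) : ℝ≥0∞ :=
  (volume.prod (volume.prod lam))
    {p : ℝ × (EuclideanSpace ℝ (Fin d)) × ℝ |
      p.1 ∈ Set.Ioc (0 : ℝ) t ∧ p.2.2 ∈ Set.Ioi (0 : ℝ) ∧
        r < heatKernel d κ p.1 p.2.1 * p.2.2}

/-- `η̄₀(r)`, the analogue of `η̄` with the restriction `|y| ≤ 1/2`. -/
def etaBar0 (d : ℕ) (κ t : ℝ) (lam : Measure ℝ) (r : ℝ) : ℝ≥0∞ :=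
  (volume.prod (volume.prod lam))
    {p : ℝ × (EuclideanSpace ℝ (Fin d)) × ℝ |
      p.1 ∈ Set.Ioc (0 : ℝ) t ∧ p.2.2 ∈ Set.Ioi (0 : ℝ) ∧ ‖p.2.1‖ ≤ 1 / 2 ∧
        r < heatKernel d κ p.1 p.2.1 * p.2.2}

/-- `η̄_A(r)`, where the heat kernel is evaluated at `dist(y, A)`. -/
def etaBarA (d : ℕ) (κ t : ℝ) (lam : Measure ℝ)
    (A : Set (EuclideanSpace ℝ (Fin d))) (r : ℝ) : ℝ≥0∞ :=
  (volume.prod (volume.prod lam))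
    {p : ℝ × (EuclideanSpace ℝ (Fin d)) × ℝ |
      p.1 ∈ Set.Ioc (0 : ℝ) t ∧ p.2.2 ∈ Set.Ioi (0 : ℝ) ∧
        r < (2 * π * κ * p.1) ^ (-(d : ℝ) / 2) *
            Real.exp (-(Metric.infDist p.2.1 A) ^ 2 / (2 * κ * p.1)) * p.2.2}

/-- `τ̄(r) = (Leb ⊗ λ)({(s,z) ∈ (0,t] × (0,∞) : (2πκs)^{-d/2} z > r})`. -/
def tauBar (d : ℕ) (κ t : ℝ) (lam : Measure ℝ) (r : ℝ) : ℝ≥0∞ :=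
  (volume.prod lam)
    {p : ℝ × ℝ | p.1 ∈ Set.Ioc (0 : ℝ) t ∧ p.2 ∈ Set.Ioi (0 : ℝ) ∧
      r < (2 * π * κ * p.1) ^ (-(d : ℝ) / 2) * p.2}

/-- The truncated moment `M_γ(x) = ∫_{(0,x]} z^γ λ(dz)`. -/
def Mgamma (lam : Measure ℝ) (γ x : ℝ) : ℝ≥0∞ :=
  ∫⁻ z in Set.Ioc (0 : ℝ) x, ENNReal.ofReal (z ^ γ) ∂lam

/-- A measurable function, positive on `[1,∞)`, is slowly varying at infinity if
`ℓ(cx)/ℓ(x) → 1` as `x → ∞` for every `c > 0`. -/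
def SlowlyVarying (ℓ : ℝ → ℝ) : Prop :=
  Measurable ℓ ∧ (∀ x ≥ (1 : ℝ), 0 < ℓ x) ∧
    ∀ c > (0 : ℝ), Tendsto (fun x => ℓ (c * x) / ℓ x) atTop (𝓝 1)

/-- Regular variation at infinity with index `-α`: `f` is eventually positive and
`f(cr)/f(r) → c^{-α}` as `r → ∞` for every `c > 0`. -/
def RegVaryNeg (f : ℝ → ℝ) (α : ℝ) : Prop :=
  (∀ᶠ r in atTop, 0 < f r) ∧
    ∀ c > (0 : ℝ), Tendsto (fun r => f (c * r) / f r) atTop (𝓝 (c ^ (-α)))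

/-- Condition (E): the necessary and sufficient condition for existence of the solution. -/
def ConditionE (d : ℕ) (lam : Measure ℝ) : Prop :=
  (∫⁻ z in Set.Ioi (1 : ℝ), ENNReal.ofReal (Real.log z ^ ((d : ℝ) / 2)) ∂lam < ⊤) ∧
  (d = 1 → ∫⁻ z in Set.Ioc (0 : ℝ) 1, ENNReal.ofReal (z ^ 2) ∂lam < ⊤) ∧
  (d = 2 → ∫⁻ z in Set.Ioc (0 : ℝ) 1, ENNReal.ofReal (z ^ 2 * |Real.log z|) ∂lam < ⊤) ∧
  (3 ≤ d → ∫⁻ z in Set.Ioc (0 : ℝ) 1, ENNReal.ofReal (z ^ (1 + 2 / (d : ℝ))) ∂lam < ⊤)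

/-- Condition (F): `∫_{(0,1)} z^{2/d} λ(dz) < ∞` if `d ≠ 2`,
and `∫_{(0,1)} z |log z| λ(dz) < ∞` if `d = 2`. -/
def ConditionF (d : ℕ) (lam : Measure ℝ) : Prop :=
  (d ≠ 2 → ∫⁻ z in Set.Ioo (0 : ℝ) 1, ENNReal.ofReal (z ^ ((2 : ℝ) / d)) ∂lam < ⊤) ∧
  (d = 2 → ∫⁻ z in Set.Ioo (0 : ℝ) 1, ENNReal.ofReal (z * |Real.log z|) ∂lam < ⊤)

lemma sFinite_of_lintegral_ne_top {α : Type*} [MeasurableSpace α] {μ : Measure α} {f : α → ℝ≥0∞}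
    (hf : Measurable f) (hpos : ∀ᵐ x ∂μ, f x ≠ 0) (hfin : ∫⁻ x, f x ∂μ ≠ ⊤) : SFinite μ := by
  have hlt : ∀ᵐ x ∂μ, f x ≠ ⊤ := (ae_lt_top hf hfin).mono fun x hx => hx.ne
  have : IsFiniteMeasure (μ.withDensity f) := isFiniteMeasure_withDensity hfin
  rw [← withDensity_inv_same hf hpos hlt]
  infer_instance

lemma IsLevyMeasure.sFinite_restrict_Ioi {lam : Measure ℝ} (h : IsLevyMeasure lam) :
    SFinite (lam.restrict (Ioi 0)) := by
  refine sFinite_of_lintegral_ne_top (f := fun z => ENNReal.ofReal (min 1 (z ^ 2)))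
    (by fun_prop) ?_ h.2.2.ne
  filter_upwards [ae_restrict_mem measurableSet_Ioi] with z hz
  have hz : 0 < z := hz
  have : 0 < min 1 (z ^ 2) := by positivity
  exact (ENNReal.ofReal_pos.2 this).ne'

lemma IsLevyMeasure.measure_Ioi_one_ne_top {lam : Measure ℝ} (h : IsLevyMeasure lam) :
    lam (Ioi 1) ≠ ⊤ := by
  refine ne_top_of_le_ne_top h.2.2.ne ?_
  calc lam (Ioi 1) = ∫⁻ _ in Ioi (1 : ℝ), 1 ∂lam := by simp
    _ ≤ ∫⁻ z in Ioi (1 : ℝ), ENNReal.ofReal (min 1 (z ^ 2)) ∂lam := by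
      refine setLIntegral_mono' measurableSet_Ioi fun z hz => ?_
      have hz : 1 < z := hz
      rw [min_eq_left (by nlinarith)]
      simp
    _ ≤ _ := lintegral_mono_set (Ioi_subset_Ioi zero_le_one)

lemma lintegral_ofReal_mul_exp_neg_norm_sq_div (d : ℕ) {a c : ℝ} (ha : 0 < a) (hc : 0 ≤ c) :
    ∫⁻ y : EuclideanSpace ℝ (Fin d), ENNReal.ofReal (c * Real.exp (-‖y‖ ^ 2 / a)) =
      ENNReal.ofReal (c * (π * a) ^ ((d : ℝ) / 2)) := by
  have key : ∫ y : EuclideanSpace ℝ (Fin d), Real.exp (-‖y‖ ^ 2 / a) =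
      (π * a) ^ ((d : ℝ) / 2) := by
    have := GaussianFourier.integral_rexp_neg_mul_sq_norm (V := EuclideanSpace ℝ (Fin d))
      (inv_pos.2 ha)
    rw [finrank_euclideanSpace_fin, div_inv_eq_mul] at this
    rw [← this]
    congr 1 with y
    congr 1
    field_simp
  have hint : Integrable fun y : EuclideanSpace ℝ (Fin d) => Real.exp (-‖y‖ ^ 2 / a) := by
    refine Integrable.of_integral_ne_zero ?_
    rw [key]
    positivity
  rw [← key, ← integral_const_mul,
    ofReal_integral_eq_lintegral_ofReal (hint.const_mul c) (ae_of_all _ fun y => by positivity)]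

lemma measurable_heatKernel (d : ℕ) (κ : ℝ) :
    Measurable fun p : ℝ × EuclideanSpace ℝ (Fin d) => heatKernel d κ p.1 p.2 := by
  unfold heatKernel
  fun_prop

lemma heatKernel_nonneg (d : ℕ) {κ s : ℝ} (hκ : 0 < κ) (hs : 0 < s)
    (y : EuclideanSpace ℝ (Fin d)) : 0 ≤ heatKernel d κ s y := by
  unfold heatKernel
  positivity

lemma lintegral_heatKernel_mul (d : ℕ) {κ s z : ℝ} (hκ : 0 < κ) (hs : 0 < s) (hz : 0 ≤ z) :
    ∫⁻ y, ENNReal.ofReal (heatKernel d κ s y * z) = ENNReal.ofReal z := by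
  have ha : 0 < 2 * π * κ * s := by positivity
  have h := lintegral_ofReal_mul_exp_neg_norm_sq_div d (a := 2 * κ * s)
    (c := (2 * π * κ * s) ^ (-(d : ℝ) / 2) * z) (by positivity) (by positivity)
  rw [show π * (2 * κ * s) = 2 * π * κ * s by ring,
    mul_right_comm _ z (_ ^ ((d : ℝ) / 2)), ← rpow_add ha,
    show -(d : ℝ) / 2 + d / 2 = 0 by ring, rpow_zero, one_mul] at h
  rw [← h]
  congr 1 with y
  unfold heatKernel
  congr 1
  ring

/-- A uniform lower bound for the heat kernel on `[t/2, t]`. -/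
lemma le_heatKernel (d : ℕ) {κ s t : ℝ} (hκ : 0 < κ) (hs : 0 < s) (hst : s ≤ t) (hts : t / 2 ≤ s)
    (y : EuclideanSpace ℝ (Fin d)) :
    (2 * π * κ * t) ^ (-(d : ℝ) / 2) * Real.exp (-(‖y‖ ^ 2 / (κ * t))) ≤ heatKernel d κ s y := by
  have ht : 0 < t := hs.trans_le hst
  unfold heatKernel
  refine mul_le_mul ?_ ?_ (by positivity) (by positivity)
  · refine rpow_le_rpow_of_nonpos (by positivity) (by gcongr) ?_
    have : (0 : ℝ) ≤ d := d.cast_nonneg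
    linarith
  · rw [Real.exp_le_exp, neg_div, neg_le_neg_iff]
    refine div_le_div_of_nonneg_left (by positivity) (by positivity) ?_
    nlinarith

/-- The integral `∫_0^t ∫_{ℝ^d} min(1, g(s,y) z) dy ds`. -/
def truncatedMass (d : ℕ) (κ t z : ℝ) : ℝ≥0∞ :=
  ∫⁻ s in Ioc (0 : ℝ) t, ∫⁻ y : EuclideanSpace ℝ (Fin d),
    ENNReal.ofReal (min 1 (heatKernel d κ s y * z))

lemma lintegral_lintegral_lintegral_eq (d : ℕ) (κ t : ℝ) (μ : Measure ℝ) [SFinite μ] :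
    ∫⁻ s in Ioc (0 : ℝ) t, ∫⁻ y : EuclideanSpace ℝ (Fin d), ∫⁻ z,
      ENNReal.ofReal (min 1 (heatKernel d κ s y * z)) ∂μ = ∫⁻ z, truncatedMass d κ t z ∂μ := by
  have hg := measurable_heatKernel d κ
  unfold truncatedMass
  have hF : Measurable fun p : (ℝ × ℝ) × EuclideanSpace ℝ (Fin d) =>
      ENNReal.ofReal (min 1 (heatKernel d κ p.1.1 p.2 * p.1.2)) :=
    (measurable_const.min ((hg.comp (measurable_fst.fst.prodMk measurable_snd)).mul
      measurable_fst.snd)).ennreal_ofReal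
  rw [← lintegral_lintegral_swap (f := fun s z => ∫⁻ y : EuclideanSpace ℝ (Fin d),
    ENNReal.ofReal (min 1 (heatKernel d κ s y * z))) hF.lintegral_prod_right'.aemeasurable]
  refine lintegral_congr fun s => lintegral_lintegral_swap (Measurable.aemeasurable ?_)
  exact (measurable_const.min ((hg.comp (measurable_const.prodMk measurable_fst)).mul
    measurable_snd)).ennreal_ofReal

lemma truncatedMass_le (d : ℕ) {κ t z : ℝ} (hκ : 0 < κ) (hz : 0 ≤ z) :
    truncatedMass d κ t z ≤ ENNReal.ofReal z * ENNReal.ofReal t := by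
  calc truncatedMass d κ t z ≤ ∫⁻ _ in Ioc (0 : ℝ) t, ENNReal.ofReal z := by
        refine setLIntegral_mono' measurableSet_Ioc fun s hs => ?_
        rw [← lintegral_heatKernel_mul d hκ hs.1 hz]
        gcongr
        exact min_le_right _ _
    _ = _ := by simp

lemma volume_closedBall_rpow (d : ℕ) {R : ℝ} (hR : 0 ≤ R) :
    volume (Metric.closedBall (0 : EuclideanSpace ℝ (Fin d)) (√R)) =
      ENNReal.ofReal (R ^ ((d : ℝ) / 2)) *
        volume (Metric.ball (0 : EuclideanSpace ℝ (Fin d)) 1) := by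
  rw [Measure.addHaar_closedBall _ _ (sqrt_nonneg R), finrank_euclideanSpace_fin,
    sqrt_eq_rpow, ← rpow_natCast, ← rpow_mul hR, one_div_mul_eq_div]

lemma min_one_heatKernel_mul_le (d : ℕ) {κ s t z : ℝ} (hκ : 0 < κ) (hs : 0 < s) (hst : s ≤ t)
    (hz : 1 < z) (y : EuclideanSpace ℝ (Fin d)) :
    ENNReal.ofReal (min 1 (heatKernel d κ s y * z)) ≤
      (Metric.closedBall 0 √(4 * κ * t * log z)).indicator 1 y +
        ENNReal.ofReal ((2 * π * κ * s) ^ (-(d : ℝ) / 2) * Real.exp (-‖y‖ ^ 2 / (4 * κ * s))) := by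
  have hl : 0 < log z := Real.log_pos hz
  by_cases hy : y ∈ Metric.closedBall 0 √(4 * κ * t * log z)
  · rw [indicator_of_mem hy]
    refine le_add_right ?_
    simp
  · refine le_add_left (ENNReal.ofReal_le_ofReal ((min_le_right _ _).trans ?_))
    rw [mem_closedBall_zero_iff, not_le] at hy
    have hy2 : 4 * κ * t * log z ≤ ‖y‖ ^ 2 := (Real.lt_sq_of_sqrt_lt hy).le
    unfold heatKernel
    rw [mul_assoc]
    gcongr
    nth_rewrite 1 [← Real.exp_log (zero_lt_one.trans hz)]
    rw [← Real.exp_add, Real.exp_le_exp]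
    have h1 : log z ≤ ‖y‖ ^ 2 / (4 * κ * s) := by
      rw [le_div_iff₀ (by positivity)]
      have : 4 * κ * s * log z ≤ 4 * κ * t * log z := by gcongr
      linarith
    have h2 : -‖y‖ ^ 2 / (2 * κ * s) = 2 * (-‖y‖ ^ 2 / (4 * κ * s)) := by
      field_simp
      ring
    rw [h2, neg_div]
    linarith

lemma truncatedMass_le_log (d : ℕ) {κ t z : ℝ} (hκ : 0 < κ) (ht : 0 < t) (hz : 1 < z) :
    truncatedMass d κ t z ≤
      (volume (Metric.ball (0 : EuclideanSpace ℝ (Fin d)) 1) *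
          ENNReal.ofReal ((4 * κ * t) ^ ((d : ℝ) / 2)) * ENNReal.ofReal t) *
        ENNReal.ofReal (log z ^ ((d : ℝ) / 2)) +
      ENNReal.ofReal (2 ^ ((d : ℝ) / 2)) * ENNReal.ofReal t := by
  have hl : 0 < log z := Real.log_pos hz
  calc truncatedMass d κ t z
      ≤ ∫⁻ _ in Ioc (0 : ℝ) t,
          (ENNReal.ofReal ((4 * κ * t * log z) ^ ((d : ℝ) / 2)) *
            volume (Metric.ball (0 : EuclideanSpace ℝ (Fin d)) 1) +
          ENNReal.ofReal (2 ^ ((d : ℝ) / 2))) := by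
        refine setLIntegral_mono' measurableSet_Ioc fun s hs => ?_
        have hs0 : 0 < s := hs.1
        refine (lintegral_mono (min_one_heatKernel_mul_le d hκ hs.1 hs.2 hz)).trans ?_
        rw [lintegral_add_left (measurable_one.indicator Metric.isClosed_closedBall.measurableSet),
          lintegral_indicator_one Metric.isClosed_closedBall.measurableSet,
          volume_closedBall_rpow d (by positivity),
          lintegral_ofReal_mul_exp_neg_norm_sq_div d (by positivity) (by positivity)]
        gcongr
        rw [show π * (4 * κ * s) = 2 * (2 * π * κ * s) by ring,
          mul_rpow zero_le_two (by positivity), mul_left_comm, ← rpow_add (by positivity),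
          show -(d : ℝ) / 2 + d / 2 = 0 by ring, rpow_zero, mul_one]
    _ = _ := by
        rw [setLIntegral_const, Real.volume_Ioc, sub_zero, mul_rpow (by positivity) hl.le,
          ENNReal.ofReal_mul (by positivity)]
        ring

lemma le_truncatedMass (d : ℕ) {κ t z c R : ℝ} (ht : 0 < t) (hR : 0 ≤ R)
    (h : ∀ s ∈ Ioc (t / 2) t, ∀ y : EuclideanSpace ℝ (Fin d), ‖y‖ ^ 2 ≤ R →
      c ≤ min 1 (heatKernel d κ s y * z)) :
    ENNReal.ofReal c * (ENNReal.ofReal (R ^ ((d : ℝ) / 2)) *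
        volume (Metric.ball (0 : EuclideanSpace ℝ (Fin d)) 1)) * ENNReal.ofReal (t / 2) ≤
      truncatedMass d κ t z := by
  rw [← volume_closedBall_rpow d hR]
  calc _ = ∫⁻ _ in Ioc (t / 2) t,
        ∫⁻ _ in Metric.closedBall (0 : EuclideanSpace ℝ (Fin d)) (√R), ENNReal.ofReal c := by
        rw [setLIntegral_const, setLIntegral_const, Real.volume_Ioc, sub_half]
    _ ≤ ∫⁻ s in Ioc (t / 2) t, ∫⁻ y in Metric.closedBall (0 : EuclideanSpace ℝ (Fin d)) (√R),
          ENNReal.ofReal (min 1 (heatKernel d κ s y * z)) := by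
        refine setLIntegral_mono' measurableSet_Ioc fun s hs =>
          setLIntegral_mono' Metric.isClosed_closedBall.measurableSet fun y hy =>
            ENNReal.ofReal_le_ofReal (h s hs y ?_)
        rw [mem_closedBall_zero_iff] at hy
        exact (Real.le_sqrt (norm_nonneg y) hR).1 hy
    _ ≤ ∫⁻ s in Ioc (t / 2) t, ∫⁻ y : EuclideanSpace ℝ (Fin d),
          ENNReal.ofReal (min 1 (heatKernel d κ s y * z)) :=
        lintegral_mono fun s => setLIntegral_le_lintegral _ _
    _ ≤ _ := lintegral_mono_set (Ioc_subset_Ioc_left (by positivity))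

lemma exists_mul_log_le_truncatedMass (d : ℕ) {κ t : ℝ} (hκ : 0 < κ) (ht : 0 < t) :
    ∃ C : ℝ≥0∞, C ≠ 0 ∧ C ≠ ⊤ ∧ ∀ z, 1 < z →
      C * ENNReal.ofReal (log z ^ ((d : ℝ) / 2)) ≤ truncatedMass d κ t z := by
  have hc : 0 < min 1 ((2 * π * κ * t) ^ (-(d : ℝ) / 2)) := by positivity
  set c := min 1 ((2 * π * κ * t) ^ (-(d : ℝ) / 2))
  have hk : 0 < (κ * t) ^ ((d : ℝ) / 2) := by positivity
  have hB : volume (Metric.ball (0 : EuclideanSpace ℝ (Fin d)) 1) ≠ 0 :=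
    (Metric.measure_ball_pos _ _ one_pos).ne'
  have hB' : volume (Metric.ball (0 : EuclideanSpace ℝ (Fin d)) 1) ≠ ⊤ := measure_ball_lt_top.ne
  refine ⟨ENNReal.ofReal c * (ENNReal.ofReal ((κ * t) ^ ((d : ℝ) / 2)) *
    volume (Metric.ball (0 : EuclideanSpace ℝ (Fin d)) 1)) * ENNReal.ofReal (t / 2),
    ?_, ?_, fun z hz => ?_⟩
  · simp only [ne_eq, mul_eq_zero, ENNReal.ofReal_eq_zero, not_or, not_le]
    exact ⟨⟨hc, hk, hB⟩, half_pos ht⟩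
  · finiteness
  · have hl : 0 < log z := Real.log_pos hz
    refine le_trans (le_of_eq ?_) (le_truncatedMass d (c := c) (R := κ * t * log z) ht
      (by positivity) fun s hs y hy => ?_)
    · rw [mul_rpow (by positivity) hl.le, ENNReal.ofReal_mul hk.le]
      ring
    · refine le_min (min_le_left _ _) ?_
      have hz0 := zero_lt_one.trans hz
      refine le_trans ?_ (mul_le_mul_of_nonneg_right
        (le_heatKernel d hκ ((half_pos ht).trans hs.1) hs.2 hs.1.le y) hz0.le)
      rw [mul_assoc]
      refine (min_le_right _ _).trans (le_mul_of_one_le_right ?_ ?_)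
      · positivity
      nth_rewrite 1 [← Real.exp_log hz0]
      rw [← Real.exp_add, Real.one_le_exp_iff]
      have : ‖y‖ ^ 2 / (κ * t) ≤ log z := by
        rw [div_le_iff₀ (by positivity)]
        linarith
      linarith

lemma exists_mul_le_truncatedMass (d : ℕ) {κ t : ℝ} (hκ : 0 < κ) (ht : 0 < t) :
    ∃ C : ℝ≥0∞, C ≠ 0 ∧ C ≠ ⊤ ∧ ∀ z, 0 < z → z ≤ 1 →
      C * ENNReal.ofReal z ≤ truncatedMass d κ t z := by
  set b := (2 * π * κ * t) ^ (-(d : ℝ) / 2) * Real.exp (-(1 / (κ * t))) with hb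
  have hc : 0 < min 1 b := by positivity
  have hB : volume (Metric.ball (0 : EuclideanSpace ℝ (Fin d)) 1) ≠ 0 :=
    (Metric.measure_ball_pos _ _ one_pos).ne'
  have hB' : volume (Metric.ball (0 : EuclideanSpace ℝ (Fin d)) 1) ≠ ⊤ := measure_ball_lt_top.ne
  refine ⟨ENNReal.ofReal (min 1 b) * volume (Metric.ball (0 : EuclideanSpace ℝ (Fin d)) 1) *
    ENNReal.ofReal (t / 2), ?_, ?_, fun z hz hz1 => ?_⟩
  · simp only [ne_eq, mul_eq_zero, ENNReal.ofReal_eq_zero, not_or, not_le]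
    exact ⟨⟨hc, hB⟩, half_pos ht⟩
  · finiteness
  · refine le_trans (le_of_eq ?_) (le_truncatedMass d (c := min 1 b * z) (R := 1) ht
      zero_le_one fun s hs y hy => ?_)
    · rw [one_rpow, ENNReal.ofReal_one, one_mul, ENNReal.ofReal_mul hc.le]
      ring
    · refine le_min (mul_le_one₀ (min_le_left _ _) hz.le hz1)
        (mul_le_mul_of_nonneg_right ((min_le_right _ _).trans ?_) hz.le)
      refine le_trans ?_ (le_heatKernel d hκ ((half_pos ht).trans hs.1) hs.2 hs.1.le y)
      rw [hb]
      gcongr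

lemma lintegral_lt_top_of_const_mul_le {α : Type*} [MeasurableSpace α] {μ : Measure α}
    {s : Set α} (hs : MeasurableSet s) {f g : α → ℝ≥0∞} {C : ℝ≥0∞} (hC : C ≠ 0) (hC' : C ≠ ⊤)
    (h : ∀ x ∈ s, C * f x ≤ g x) (hg : ∫⁻ x in s, g x ∂μ < ⊤) : ∫⁻ x in s, f x ∂μ < ⊤ := by
  have h1 := (setLIntegral_mono' hs h).trans_lt hg
  rw [lintegral_const_mul' _ _ hC'] at h1
  exact (ENNReal.mul_lt_top_iff.1 h1).elim (fun h => h.2)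
    fun h => h.elim (fun h => absurd h hC) fun h => h.trans_lt ENNReal.zero_lt_top

/-- Theorem 1.2 (ii), existence part: the integral
`∫_0^t ∫_{ℝ^d} ∫_{(0,∞)} min(1, g(s,y)z) λ(dz) dy ds` is finite iff
`∫_{(1,∞)} (log z)^{d/2} λ(dz) < ∞` and `∫_{(0,1]} z λ(dz) < ∞`. -/
theorem stmt_0 (d : ℕ) (hd : 1 ≤ d) (κ t : ℝ) (hκ : 0 < κ) (ht : 0 < t)
    (lam : Measure ℝ) (hlam : IsLevyMeasure lam) :
    (∫⁻ s in Set.Ioc (0 : ℝ) t, ∫⁻ y : EuclideanSpace ℝ (Fin d),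
        ∫⁻ z in Set.Ioi (0 : ℝ),
          ENNReal.ofReal (min 1 (heatKernel d κ s y * z)) ∂lam) < ⊤ ↔
      ((∫⁻ z in Set.Ioi (1 : ℝ), ENNReal.ofReal (Real.log z ^ ((d : ℝ) / 2)) ∂lam < ⊤) ∧
        (∫⁻ z in Set.Ioc (0 : ℝ) 1, ENNReal.ofReal z ∂lam < ⊤)) := by
  have := hlam.sFinite_restrict_Ioi
  rw [lintegral_lintegral_lintegral_eq, ← Ioc_union_Ioi_eq_Ioi zero_le_one,
    lintegral_union measurableSet_Ioi (Ioc_disjoint_Ioi le_rfl), ENNReal.add_lt_top, and_comm]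
  refine and_congr ⟨fun h => ?_, fun h => ?_⟩ ⟨fun h => ?_, fun h => ?_⟩
  · obtain ⟨C, hC, hC', hle⟩ := exists_mul_log_le_truncatedMass d hκ ht
    exact lintegral_lt_top_of_const_mul_le measurableSet_Ioi hC hC' hle h
  · refine (setLIntegral_mono' measurableSet_Ioi fun z hz =>
      truncatedMass_le_log d hκ ht hz).trans_lt ?_
    have hB : volume (Metric.ball (0 : EuclideanSpace ℝ (Fin d)) 1) ≠ ⊤ := measure_ball_lt_top.ne
    have h1 := hlam.measure_Ioi_one_ne_top
    have h2 := h.ne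
    rw [lintegral_add_right _ measurable_const, lintegral_const_mul' _ _ (by finiteness),
      setLIntegral_const]
    finiteness
  · obtain ⟨C, hC, hC', hle⟩ := exists_mul_le_truncatedMass d hκ ht
    exact lintegral_lt_top_of_const_mul_le measurableSet_Ioc hC hC' (fun z hz => hle z hz.1 hz.2) h
  · refine (setLIntegral_mono' measurableSet_Ioc fun z hz =>
      truncatedMass_le d hκ hz.1.le).trans_lt ?_
    rw [lintegral_mul_const' _ _ (by finiteness)]
    exact ENNReal.mul_lt_top h ENNReal.ofReal_lt_top
end
end

section
/- Let λ be a Lévy measure on (0,∞) with m_{1+2/d}(λ) = ∫_{(0,∞)} z^{1+2/d} λ(dz) < ∞. Then η̄(r) ~ r^{-1-2/d} · (d^{d/2} / (πκ (d+2)^{d/2+1})) · m_{1+2/d}(λ) as r → ∞, i.e. the ratio of the two sides tends to 1. -/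
open MeasureTheory Real Filter Set
open scoped ENNReal Topology

noncomputable section

/-- The profile `(-x log x)₊ ^ (d/2)`, to which the volumes of the superlevel sets of the heat kernel
are proportional after rescaling time. -/
def heatProfile (d : ℕ) (x : ℝ) : ℝ := (max 0 (negMulLog x)) ^ ((d : ℝ) / 2)

lemma measurable_heatProfile (d : ℕ) : Measurable (heatProfile d) := by
  unfold heatProfile
  have : Measurable negMulLog := continuous_negMulLog.measurable
  fun_prop

lemma heatProfile_nonneg (d : ℕ) (x : ℝ) : 0 ≤ heatProfile d x :=
  rpow_nonneg (le_max_left _ _) _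

lemma heatProfile_of_one_le {d : ℕ} (hd : 1 ≤ d) {x : ℝ} (hx : 1 ≤ x) : heatProfile d x = 0 := by
  have h : negMulLog x ≤ 0 := by
    rw [negMulLog, neg_mul, neg_nonpos]
    exact mul_nonneg (by linarith) (log_nonneg hx)
  rw [heatProfile, max_eq_left h, zero_rpow (by positivity)]

lemma lt_heatKernel_iff {d : ℕ} (hd : 1 ≤ d) {κ s u : ℝ} (hκ : 0 < κ) (hs : 0 < s) (hu : 0 < u)
    (y : EuclideanSpace ℝ (Fin d)) :
    u < heatKernel d κ s y ↔
      ‖y‖ ^ 2 < (d : ℝ) / (2 * π) * u ^ (-(2 / (d : ℝ))) *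
        negMulLog (2 * π * κ * u ^ (2 / (d : ℝ)) * s) := by
  have hd0 : (0 : ℝ) < d := by exact_mod_cast hd
  have hpos : 0 < (2 * π * κ * s) ^ (-(d : ℝ) / 2) := by positivity
  have hlog : log (2 * π * κ * u ^ (2 / (d : ℝ)) * s)
      = log (2 * π * κ * s) + 2 / d * log u := by
    rw [← log_rpow hu, ← log_mul (by positivity) (by positivity)]
    congr 1; ring
  have hrhs : (d : ℝ) / (2 * π) * u ^ (-(2 / (d : ℝ))) *
        negMulLog (2 * π * κ * u ^ (2 / (d : ℝ)) * s) =
      (2 * κ * s) * (-(d : ℝ) / 2 * log (2 * π * κ * s) - log u) := by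
    rw [negMulLog, hlog, rpow_neg hu.le]
    have := (rpow_pos_of_pos hu (2 / (d : ℝ))).ne'
    field_simp
    ring
  have hexp : -‖y‖ ^ 2 / (2 * κ * s) = -(‖y‖ ^ 2 / (2 * κ * s)) := by ring
  rw [hrhs, heatKernel, ← log_lt_log_iff hu (by positivity),
    log_mul hpos.ne' (exp_pos _).ne', log_exp, log_rpow (by positivity), hexp,
    ← div_lt_iff₀' (by positivity : 0 < 2 * κ * s)]
  constructor <;> intro h <;> linarith

/-- The constant relating superlevel volumes of the heat kernel to `heatProfile`. -/
def heatSliceConst (d : ℕ) : ℝ :=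
  ((d : ℝ) / (2 * π)) ^ ((d : ℝ) / 2) * (√π ^ d / Gamma ((d : ℝ) / 2 + 1))

lemma heatSliceConst_nonneg (d : ℕ) : 0 ≤ heatSliceConst d := by
  have := Gamma_pos_of_pos (by positivity : (0 : ℝ) < (d : ℝ) / 2 + 1)
  unfold heatSliceConst
  positivity

lemma volume_lt_heatKernel {d : ℕ} (hd : 1 ≤ d) {κ s u : ℝ} (hκ : 0 < κ) (hs : 0 < s)
    (hu : 0 < u) :
    volume {y : EuclideanSpace ℝ (Fin d) | u < heatKernel d κ s y} =
      ENNReal.ofReal (heatSliceConst d * u⁻¹ *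
        heatProfile d (2 * π * κ * u ^ (2 / (d : ℝ)) * s)) := by
  have hd0 : (0 : ℝ) < d := by exact_mod_cast hd
  have : Nonempty (Fin d) := ⟨⟨0, hd⟩⟩
  set L := negMulLog (2 * π * κ * u ^ (2 / (d : ℝ)) * s)
  set ρ := (d : ℝ) / (2 * π) * u ^ (-(2 / (d : ℝ))) * L
  have hset : {y : EuclideanSpace ℝ (Fin d) | u < heatKernel d κ s y} =
      Metric.ball 0 (√(max 0 ρ)) := by
    ext y
    have hmax : ‖y‖ ^ 2 < ρ ↔ ‖y‖ ^ 2 < max 0 ρ := by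
      rw [lt_max_iff]
      exact ⟨Or.inr, fun h => h.resolve_left (not_lt.2 (sq_nonneg _))⟩
    rw [mem_ofPred_eq, lt_heatKernel_iff hd hκ hs hu, mem_ball_zero_iff,
      lt_sqrt (norm_nonneg _), ← hmax]
  have hmaxρ : max 0 ρ = (d : ℝ) / (2 * π) * u ^ (-(2 / (d : ℝ))) * max 0 L := by
    rw [mul_max_of_nonneg _ _ (by positivity), mul_zero]
  have hpow : √(max 0 ρ) ^ d = ((d : ℝ) / (2 * π)) ^ ((d : ℝ) / 2) * u⁻¹ *
      (max 0 L) ^ ((d : ℝ) / 2) := by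
    rw [sqrt_eq_rpow, ← rpow_natCast, ← rpow_mul (le_max_left _ _), hmaxρ,
      one_div_mul_eq_div, mul_rpow (by positivity) (le_max_left _ _),
      mul_rpow (by positivity) (by positivity), ← rpow_mul hu.le]
    congr 2
    rw [← rpow_neg_one]
    congr 1
    field_simp
  rw [hset, EuclideanSpace.volume_ball, ← ENNReal.ofReal_pow (sqrt_nonneg _),
    ← ENNReal.ofReal_mul (by positivity), Fintype.card_fin, hpow, heatSliceConst, heatProfile]
  congr 1
  ring

/-- The truncated integral of `heatProfile`. -/
def heatProfileIntegral (d : ℕ) (T : ℝ) : ℝ≥0∞ :=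
  ∫⁻ x in Ioc 0 T, ENNReal.ofReal (heatProfile d x)

lemma monotone_heatProfileIntegral (d : ℕ) : Monotone (heatProfileIntegral d) := fun _ _ h =>
  lintegral_mono_set (Ioc_subset_Ioc_right h)

lemma heatProfileIntegral_of_one_le {d : ℕ} (hd : 1 ≤ d) {T : ℝ} (hT : 1 ≤ T) :
    heatProfileIntegral d T = heatProfileIntegral d 1 := by
  have h0 : ∫⁻ x in Ioc 1 T, ENNReal.ofReal (heatProfile d x) = 0 := by
    rw [setLIntegral_congr_fun (g := fun _ => 0) measurableSet_Ioc, lintegral_zero]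
    intro x hx
    simp [heatProfile_of_one_le hd hx.1.le]
  rw [heatProfileIntegral, ← Ioc_union_Ioc_eq_Ioc zero_le_one hT,
    lintegral_union measurableSet_Ioc (Ioc_disjoint_Ioc_of_le le_rfl), h0, add_zero,
    heatProfileIntegral]

lemma heatProfileIntegral_le_one {d : ℕ} (hd : 1 ≤ d) (T : ℝ) :
    heatProfileIntegral d T ≤ heatProfileIntegral d 1 := by
  rcases le_total T 1 with h | h
  · exact monotone_heatProfileIntegral d h
  · exact (heatProfileIntegral_of_one_le hd h).le

lemma heatProfileIntegral_one (d : ℕ) :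
    heatProfileIntegral d 1 = ENNReal.ofReal
      (Gamma ((d : ℝ) / 2 + 1) / ((d : ℝ) / 2 + 1) ^ ((d : ℝ) / 2 + 1)) := by
  set a : ℝ := (d : ℝ) / 2 with ha
  have ha0 : 0 ≤ a := by positivity
  have himage : (fun y : ℝ => exp (-y)) '' Ioi 0 = Ioo 0 1 := by
    ext x
    constructor
    · rintro ⟨y, hy, rfl⟩
      exact ⟨exp_pos _, by simpa using hy⟩
    · rintro ⟨h0, h1⟩
      exact ⟨-log x, neg_pos.2 (log_neg h0 h1), by simp [exp_log h0]⟩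
  have hderiv : ∀ y ∈ Ioi (0 : ℝ),
      HasDerivWithinAt (fun y : ℝ => exp (-y)) (-exp (-y)) (Ioi 0) y := fun y _ => by
    simpa using ((hasDerivAt_neg y).exp).hasDerivWithinAt
  have hinj : InjOn (fun y : ℝ => exp (-y)) (Ioi 0) := fun x _ y _ h => by
    simpa using exp_injective h
  have hint := integral_rpow_mul_exp_neg_mul_Ioi (a := a + 1) (r := a + 1)
    (by positivity) (by positivity)
  have hΓ := Gamma_pos_of_pos (by positivity : (0 : ℝ) < a + 1)
  have hintegrable : IntegrableOn (fun y : ℝ => y ^ (a + 1 - 1) * exp (-((a + 1) * y))) (Ioi 0) := by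
    by_contra h
    rw [integral_undef h] at hint
    have : 0 < (1 / (a + 1)) ^ (a + 1) * Gamma (a + 1) := by positivity
    linarith
  have hnonneg : 0 ≤ᵐ[volume.restrict (Ioi (0 : ℝ))]
      fun y : ℝ => y ^ (a + 1 - 1) * exp (-((a + 1) * y)) := by
    filter_upwards [ae_restrict_mem measurableSet_Ioi] with y hy
    have : (0 : ℝ) < y := hy
    simp only [Pi.zero_apply]
    positivity
  have hval : Gamma (a + 1) / (a + 1) ^ (a + 1) = (1 / (a + 1)) ^ (a + 1) * Gamma (a + 1) := by
    rw [one_div, inv_rpow (by positivity)]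
    ring
  rw [heatProfileIntegral, ← setLIntegral_congr Ioo_ae_eq_Ioc, ← himage,
    lintegral_image_eq_lintegral_abs_deriv_mul measurableSet_Ioi hderiv hinj, hval, ← hint,
    ofReal_integral_eq_lintegral_ofReal hintegrable hnonneg]
  refine setLIntegral_congr_fun measurableSet_Ioi fun y hy => ?_
  have hy0 : (0 : ℝ) < y := hy
  have hL : negMulLog (exp (-y)) = y * exp (-y) := by
    rw [negMulLog, log_exp]
    ring
  rw [abs_neg, abs_of_pos (exp_pos _), ← ENNReal.ofReal_mul (exp_pos _).le, heatProfile, hL,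
    max_eq_right (by positivity), ← ha, mul_rpow hy0.le (exp_pos _).le, ← exp_mul,
    add_sub_cancel_right, mul_left_comm, ← exp_add]
  congr 3
  ring

lemma lintegral_Ioc_heatProfile_mul (d : ℕ) {b : ℝ} (hb : 0 < b) (t : ℝ) :
    ∫⁻ s in Ioc 0 t, ENNReal.ofReal (heatProfile d (b * s)) =
      ENNReal.ofReal b⁻¹ * heatProfileIntegral d (b * t) := by
  have hpre : (fun s => b * s) ⁻¹' Ioc 0 (b * t) = Ioc 0 t := by
    ext s
    simp only [mem_preimage, mem_Ioc, mul_pos_iff_of_pos_left hb, mul_le_mul_iff_right₀ hb]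
  have hmeas : Measurable fun x => ENNReal.ofReal (heatProfile d x) :=
    (measurable_heatProfile d).ennreal_ofReal
  rw [← hpre, ← setLIntegral_map measurableSet_Ioc hmeas (measurable_const_mul b),
    map_volume_mul_left hb.ne', Measure.restrict_smul, lintegral_smul_measure, smul_eq_mul,
    abs_of_pos (inv_pos.2 hb), heatProfileIntegral]

lemma lintegral_volume_lt_heatKernel {d : ℕ} (hd : 1 ≤ d) {κ u : ℝ} (hκ : 0 < κ) (hu : 0 < u)
    (t : ℝ) :
    ∫⁻ s in Ioc 0 t, volume {y : EuclideanSpace ℝ (Fin d) | u < heatKernel d κ s y} =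
      ENNReal.ofReal (heatSliceConst d / (2 * π * κ)) *
        (ENNReal.ofReal (u ^ (-(1 + 2 / (d : ℝ)))) *
          heatProfileIntegral d (2 * π * κ * u ^ (2 / (d : ℝ)) * t)) := by
  have hA := heatSliceConst_nonneg d
  have hb : 0 < 2 * π * κ * u ^ (2 / (d : ℝ)) := by positivity
  have hmeas : Measurable fun s =>
      ENNReal.ofReal (heatProfile d (2 * π * κ * u ^ (2 / (d : ℝ)) * s)) :=
    ((measurable_heatProfile d).comp (measurable_const_mul _)).ennreal_ofReal
  rw [setLIntegral_congr_fun measurableSet_Ioc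
      fun s hs => volume_lt_heatKernel (d := d) hd hκ hs.1 hu]
  simp_rw [ENNReal.ofReal_mul (mul_nonneg hA (inv_nonneg.2 hu.le))]
  rw [lintegral_const_mul _ hmeas, lintegral_Ioc_heatProfile_mul d hb, ← mul_assoc, ← mul_assoc,
    ← ENNReal.ofReal_mul (by positivity), ← ENNReal.ofReal_mul (by positivity)]
  congr 2
  rw [neg_add, rpow_add hu, rpow_neg_one, rpow_neg hu.le]
  field_simp

lemma IsLevyMeasure.ae_pos {lam : Measure ℝ} (h : IsLevyMeasure lam) :
    ∀ᵐ z ∂lam, z ∈ Ioi (0 : ℝ) := by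
  rw [ae_iff]
  convert h.2.1 using 2
  ext
  simp

lemma IsLevyMeasure.sFinite {lam : Measure ℝ} (h : IsLevyMeasure lam) : SFinite lam := by
  set f : ℝ → ℝ≥0∞ := fun z => ENNReal.ofReal (min 1 (z ^ 2)) with hf
  have hmeas : Measurable f := by fun_prop
  have hfin : ∫⁻ z, f z ∂lam ≠ ⊤ := by
    rw [← Measure.restrict_eq_self_of_ae_mem h.ae_pos]
    exact h.2.2.ne
  have hne : ∀ᵐ z ∂lam, f z ≠ 0 := by
    filter_upwards [h.ae_pos] with z hz
    have : (0 : ℝ) < z := hz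
    simp [hf, this.ne']
  have := isFiniteMeasure_withDensity hfin
  rw [← withDensity_inv_same hmeas hne (ae_of_all _ fun _ => ENNReal.ofReal_ne_top)]
  infer_instance

lemma etaBar_eq_lintegral {d : ℕ} (hd : 1 ≤ d) {κ : ℝ} (hκ : 0 < κ) (t : ℝ) {lam : Measure ℝ}
    [SFinite lam] {r : ℝ} (hr : 0 < r) :
    etaBar d κ t lam r = ENNReal.ofReal (r ^ (-(1 + 2 / (d : ℝ)))) *
      (ENNReal.ofReal (heatSliceConst d / (2 * π * κ)) *
        ∫⁻ z in Ioi 0, ENNReal.ofReal (z ^ (1 + 2 / (d : ℝ))) *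
          heatProfileIntegral d (2 * π * κ * (r / z) ^ (2 / (d : ℝ)) * t) ∂lam) := by
  set S := {p : ℝ × (EuclideanSpace ℝ (Fin d)) × ℝ |
      p.1 ∈ Set.Ioc (0 : ℝ) t ∧ p.2.2 ∈ Set.Ioi (0 : ℝ) ∧
        r < heatKernel d κ p.1 p.2.1 * p.2.2} with hS
  have hSm : MeasurableSet S := by
    have hk : Measurable fun p : ℝ × (EuclideanSpace ℝ (Fin d)) × ℝ =>
        heatKernel d κ p.1 p.2.1 * p.2.2 :=
      ((measurable_heatKernel d κ).comp
        (measurable_fst.prodMk (measurable_fst.comp measurable_snd))).mul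
        (measurable_snd.comp measurable_snd)
    exact (measurable_fst measurableSet_Ioc).inter
      (((measurable_snd.comp measurable_snd) measurableSet_Ioi).inter
        (measurableSet_lt measurable_const hk))
  have hslice : Measurable fun q : ℝ × ℝ => volume {y | (q.1, y, q.2) ∈ S} :=
    measurable_measure_prodMk_left (ν := volume)
      (s := {q : (ℝ × ℝ) × EuclideanSpace ℝ (Fin d) | (q.1.1, q.2, q.1.2) ∈ S})
      (hSm.preimage (by fun_prop))
  have hinner : ∀ z, ∫⁻ s, volume {y | (s, y, z) ∈ S} =
      (Ioi (0 : ℝ)).indicator (fun z => ENNReal.ofReal (r ^ (-(1 + 2 / (d : ℝ)))) *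
        (ENNReal.ofReal (heatSliceConst d / (2 * π * κ)) *
        (ENNReal.ofReal (z ^ (1 + 2 / (d : ℝ))) *
          heatProfileIntegral d (2 * π * κ * (r / z) ^ (2 / (d : ℝ)) * t)))) z := by
    intro z
    by_cases hz : z ∈ Ioi (0 : ℝ)
    · have hz0 : 0 < z := hz
      rw [indicator_of_mem hz]
      have hind : ∀ s, volume {y | (s, y, z) ∈ S} = (Ioc 0 t).indicator
          (fun s => volume {y : EuclideanSpace ℝ (Fin d) | r / z < heatKernel d κ s y}) s := by
        intro s
        by_cases hs : s ∈ Ioc 0 t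
        · rw [indicator_of_mem hs]
          congr 1
          ext y
          simp only [hS, mem_ofPred_eq, hs, hz, true_and, div_lt_iff₀ hz0]
        · rw [indicator_of_notMem hs]
          have : {y | (s, y, z) ∈ S} = ∅ := eq_empty_of_forall_notMem fun y hy => hs hy.1
          rw [this, measure_empty]
      simp_rw [hind]
      rw [lintegral_indicator measurableSet_Ioc,
        lintegral_volume_lt_heatKernel hd hκ (div_pos hr hz0)]
      have hpow : (r / z) ^ (-(1 + 2 / (d : ℝ))) =
          r ^ (-(1 + 2 / (d : ℝ))) * z ^ (1 + 2 / (d : ℝ)) := by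
        rw [div_rpow hr.le hz0.le, rpow_neg hz0.le, div_inv_eq_mul]
      rw [hpow, ENNReal.ofReal_mul (by positivity)]
      ring
    · rw [indicator_of_notMem hz]
      have (s : ℝ) : {y | (s, y, z) ∈ S} = ∅ := eq_empty_of_forall_notMem fun y hy => hz hy.2.1
      simp_rw [this, measure_empty, lintegral_zero]
  have hGm : Measurable fun z : ℝ => ENNReal.ofReal (z ^ (1 + 2 / (d : ℝ))) *
      heatProfileIntegral d (2 * π * κ * (r / z) ^ (2 / (d : ℝ)) * t) :=
    Measurable.mul (by fun_prop)
      ((monotone_heatProfileIntegral d).measurable.comp (by fun_prop))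
  calc etaBar d κ t lam r = ∫⁻ s, ∫⁻ z, volume {y | (s, y, z) ∈ S} ∂lam := by
        rw [etaBar, Measure.prod_apply hSm]
        refine lintegral_congr fun s => ?_
        rw [Measure.prod_apply_symm (measurable_prodMk_left hSm)]
        rfl
    _ = ∫⁻ z, (∫⁻ s, volume {y | (s, y, z) ∈ S}) ∂lam := lintegral_lintegral_swap hslice.aemeasurable
    _ = _ := by
        simp_rw [hinner]
        rw [lintegral_indicator measurableSet_Ioi, lintegral_const_mul _ (hGm.const_mul _),
          lintegral_const_mul _ hGm]

lemma heatSliceConst_mul_Gamma {d : ℕ} (hd : 1 ≤ d) {κ : ℝ} (hκ : 0 < κ) :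
    heatSliceConst d / (2 * π * κ) *
        (Gamma ((d : ℝ) / 2 + 1) / ((d : ℝ) / 2 + 1) ^ ((d : ℝ) / 2 + 1)) =
      (d : ℝ) ^ ((d : ℝ) / 2) / (π * κ * ((d : ℝ) + 2) ^ ((d : ℝ) / 2 + 1)) := by
  have hd0 : (0 : ℝ) < d := by exact_mod_cast hd
  have hΓ := Gamma_pos_of_pos (by positivity : (0 : ℝ) < (d : ℝ) / 2 + 1)
  have hsqrt : √π ^ d = π ^ ((d : ℝ) / 2) := by
    rw [sqrt_eq_rpow, ← rpow_natCast, ← rpow_mul pi_pos.le, one_div_mul_eq_div]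
  have hhalf : (d : ℝ) / 2 + 1 = (d + 2) / 2 := by ring
  have hden : ((d : ℝ) / 2 + 1) ^ ((d : ℝ) / 2 + 1) =
      (d + 2) ^ ((d : ℝ) / 2 + 1) / (2 ^ ((d : ℝ) / 2) * 2) := by
    nth_rewrite 1 [hhalf]
    rw [div_rpow (by positivity) zero_le_two, rpow_add_one (two_ne_zero : (2 : ℝ) ≠ 0)]
  rw [heatSliceConst, hsqrt, hden, div_rpow hd0.le (by positivity), mul_rpow zero_le_two pi_pos.le]
  field_simp

lemma tendsto_lintegral_heatProfileIntegral {d : ℕ} (hd : 1 ≤ d) {κ t : ℝ} (hκ : 0 < κ)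
    (ht : 0 < t) {lam : Measure ℝ}
    (hm : ∫⁻ z in Ioi (0 : ℝ), ENNReal.ofReal (z ^ (1 + 2 / (d : ℝ))) ∂lam < ⊤) :
    Tendsto (fun r : ℝ => ∫⁻ z in Ioi 0, ENNReal.ofReal (z ^ (1 + 2 / (d : ℝ))) *
          heatProfileIntegral d (2 * π * κ * (r / z) ^ (2 / (d : ℝ)) * t) ∂lam) atTop
      (𝓝 ((∫⁻ z in Ioi (0 : ℝ), ENNReal.ofReal (z ^ (1 + 2 / (d : ℝ))) ∂lam) *
        heatProfileIntegral d 1)) := by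
  have hd0 : (0 : ℝ) < d := by exact_mod_cast hd
  have hmeas : Measurable fun z : ℝ => ENNReal.ofReal (z ^ (1 + 2 / (d : ℝ))) := by fun_prop
  have hI : heatProfileIntegral d 1 ≠ ⊤ := by
    rw [heatProfileIntegral_one]
    exact ENNReal.ofReal_ne_top
  rw [← lintegral_mul_const _ hmeas]
  refine tendsto_lintegral_filter_of_dominated_convergence
    (fun z => ENNReal.ofReal (z ^ (1 + 2 / (d : ℝ))) * heatProfileIntegral d 1)
    (.of_forall fun r => hmeas.mul
      ((monotone_heatProfileIntegral d).measurable.comp (by fun_prop)))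
    (.of_forall fun r => ae_of_all _ fun z => by
      gcongr
      exact heatProfileIntegral_le_one hd _) ?_ ?_
  · rw [lintegral_mul_const _ hmeas]
    exact ENNReal.mul_ne_top hm.ne hI
  · filter_upwards [ae_restrict_mem measurableSet_Ioi] with z hz
    have harg : Tendsto (fun r : ℝ => 2 * π * κ * (r / z) ^ (2 / (d : ℝ)) * t) atTop atTop :=
      ((((tendsto_rpow_atTop (by positivity)).comp
        (tendsto_id.atTop_div_const hz)).const_mul_atTop (by positivity)).atTop_mul_const ht)
    refine tendsto_const_nhds.congr' ?_
    filter_upwards [harg.eventually_ge_atTop 1] with r h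
    rw [heatProfileIntegral_of_one_le hd h]

lemma IsLevyMeasure.lintegral_rpow_ne_zero {lam : Measure ℝ} (h : IsLevyMeasure lam) (p : ℝ) :
    ∫⁻ z in Ioi (0 : ℝ), ENNReal.ofReal (z ^ p) ∂lam ≠ 0 := by
  rw [Measure.restrict_eq_self_of_ae_mem h.ae_pos, Ne, lintegral_eq_zero_iff (by fun_prop)]
  intro h0
  refine h.1 (ae_eq_bot.1 (eventually_false_iff_eq_bot.1 ?_))
  filter_upwards [h.ae_pos, h0] with z hz hz0
  exact (rpow_pos_of_pos hz p).not_ge (ENNReal.ofReal_eq_zero.1 hz0)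

/-- Lemma 2.2 (i): if `m_{1+2/d}(λ) < ∞` then
`η̄(r) ~ r^{-1-2/d} · d^{d/2}/(πκ(d+2)^{d/2+1}) · m_{1+2/d}(λ)` as `r → ∞`. -/
theorem stmt_3 (d : ℕ) (hd : 1 ≤ d) (κ t : ℝ) (hκ : 0 < κ) (ht : 0 < t)
    (lam : Measure ℝ) (hlam : IsLevyMeasure lam)
    (hm : ∫⁻ z in Set.Ioi (0 : ℝ), ENNReal.ofReal (z ^ (1 + 2 / (d : ℝ))) ∂lam < ⊤) :
    Tendsto (fun r : ℝ =>
        (etaBar d κ t lam r).toReal /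
          (r ^ (-(1 + 2 / (d : ℝ))) *
            ((d : ℝ) ^ ((d : ℝ) / 2) / (π * κ * ((d : ℝ) + 2) ^ ((d : ℝ) / 2 + 1))) *
            (∫⁻ z in Set.Ioi (0 : ℝ),
              ENNReal.ofReal (z ^ (1 + 2 / (d : ℝ))) ∂lam).toReal))
      atTop (𝓝 1) := by
  have := hlam.sFinite
  set m := ∫⁻ z in Set.Ioi (0 : ℝ), ENNReal.ofReal (z ^ (1 + 2 / (d : ℝ))) ∂lam
  set C := (d : ℝ) ^ ((d : ℝ) / 2) / (π * κ * ((d : ℝ) + 2) ^ ((d : ℝ) / 2 + 1))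
  have hd0 : (0 : ℝ) < d := by exact_mod_cast hd
  have hCpos : 0 < C := by positivity
  have hmpos : 0 < m.toReal := ENNReal.toReal_pos (hlam.lintegral_rpow_ne_zero _) hm.ne
  have hA : 0 ≤ heatSliceConst d / (2 * π * κ) :=
    div_nonneg (heatSliceConst_nonneg d) (by positivity)
  have hlimit : ENNReal.ofReal (heatSliceConst d / (2 * π * κ)) *
      (m * heatProfileIntegral d 1) = ENNReal.ofReal C * m := by
    rw [heatProfileIntegral_one, mul_left_comm, ← ENNReal.ofReal_mul hA,
      heatSliceConst_mul_Gamma hd hκ, mul_comm]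
  have hlim := ENNReal.Tendsto.const_mul (a := ENNReal.ofReal (heatSliceConst d / (2 * π * κ)))
    (tendsto_lintegral_heatProfileIntegral hd hκ ht hm) (Or.inr ENNReal.ofReal_ne_top)
  rw [hlimit] at hlim
  have hreal := ((ENNReal.tendsto_toReal
    (ENNReal.mul_ne_top ENNReal.ofReal_ne_top hm.ne)).comp hlim).div_const (C * m.toReal)
  rw [ENNReal.toReal_mul, ENNReal.toReal_ofReal hCpos.le, div_self (by positivity)] at hreal
  refine hreal.congr' ?_
  filter_upwards [eventually_gt_atTop 0] with r hr
  have hrp : 0 < r ^ (-(1 + 2 / (d : ℝ))) := rpow_pos_of_pos hr _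
  rw [etaBar_eq_lintegral hd hκ t hr, ENNReal.toReal_mul, ENNReal.toReal_ofReal hrp.le,
    mul_assoc (r ^ _),
    mul_div_mul_left _ _ hrp.ne']
  rfl
end
end
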